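/- arXiv:0905.1388 — 2 statements merged into one kernel-verified Lean document; each statement's English description precedes it below -/
import Mathlib

section
/- Let α, β be real numbers with β ≠ 0, α + β > −1 and α − β > −1. Then for every z ∈ ℝ the strict inequality f_{α+β}'(z)·f_{α−β}'(z) > (f_α'(z))² holds, where f_γ' denotes the derivative of the Fermi function f_γ. -/
open Set MeasureTheory

/-- The Fermi function of order `α`. -/
noncomputable def fermi (α z : ℝ) : ℝ :=
  ∫ x in Set.Ioi (0:ℝ), x ^ α / (1 + Real.exp (x - z))

noncomputable def fermiKer (z x : ℝ) : ℝ := Real.exp (x - z) / (1 + Real.exp (x - z)) ^ 2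

lemma fermiKer_pos (z x : ℝ) : 0 < fermiKer z x := by
  unfold fermiKer; positivity

lemma fermiKer_le (z x : ℝ) : fermiKer z x ≤ Real.exp z * Real.exp (-x) := by
  unfold fermiKer
  have h : Real.exp z * Real.exp (-x) = (Real.exp (x - z))⁻¹ := by
    rw [← Real.exp_add, ← Real.exp_neg]; congr 1; ring
  rw [h]
  have := Real.exp_pos (x - z)
  generalize Real.exp (x - z) = u at *
  rw [div_le_iff₀ (by positivity), inv_mul_eq_div, le_div_iff₀ this]
  nlinarith

lemma gamma_int (a : ℝ) (ha : -1 < a) :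
    IntegrableOn (fun x : ℝ => x ^ a * Real.exp (-x)) (Ioi 0) := by
  have := Real.GammaIntegral_convergent (s := a + 1) (by linarith)
  simpa [mul_comm] using this

lemma fermi_meas (a z : ℝ) :
    AEStronglyMeasurable (fun x : ℝ => x ^ a / (1 + Real.exp (x - z)))
      (volume.restrict (Ioi 0)) := by
  apply Measurable.aestronglyMeasurable
  fun_prop

lemma ker_meas (a z : ℝ) :
    AEStronglyMeasurable (fun x : ℝ => x ^ a * fermiKer z x)
      (volume.restrict (Ioi 0)) := by
  apply Measurable.aestronglyMeasurable
  unfold fermiKer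
  fun_prop

lemma ker_int (a z : ℝ) (ha : -1 < a) :
    IntegrableOn (fun x : ℝ => x ^ a * fermiKer z x) (Ioi 0) := by
  refine Integrable.mono' ((gamma_int a ha).const_mul (Real.exp z)) (ker_meas a z) ?_
  refine (ae_restrict_iff' measurableSet_Ioi).2 (Filter.Eventually.of_forall fun x hx => ?_)
  have hp : 0 < x ^ a := Real.rpow_pos_of_pos hx a
  rw [Real.norm_of_nonneg (mul_pos hp (fermiKer_pos z x)).le]
  have := mul_le_mul_of_nonneg_left (fermiKer_le z x) hp.le
  linarith

lemma fermi_int (a z : ℝ) (ha : -1 < a) :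
    IntegrableOn (fun x : ℝ => x ^ a / (1 + Real.exp (x - z))) (Ioi 0) := by
  refine Integrable.mono' ((gamma_int a ha).const_mul (Real.exp z)) (fermi_meas a z) ?_
  refine (ae_restrict_iff' measurableSet_Ioi).2 (Filter.Eventually.of_forall fun x hx => ?_)
  have hp : 0 < x ^ a := Real.rpow_pos_of_pos hx a
  rw [Real.norm_of_nonneg (by positivity)]
  have h : Real.exp z * (x ^ a * Real.exp (-x)) = x ^ a / Real.exp (x - z) := by
    rw [Real.exp_sub, Real.exp_neg]; field_simp
  rw [h]
  gcongr
  linarith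

lemma fermi_deriv (a z : ℝ) (ha : -1 < a) :
    deriv (fermi a) z = ∫ x in Ioi (0:ℝ), x ^ a * fermiKer z x := by
  have key := hasDerivAt_integral_of_dominated_loc_of_deriv_le
    (μ := volume.restrict (Ioi (0:ℝ)))
    (F := fun z x : ℝ => x ^ a / (1 + Real.exp (x - z)))
    (F' := fun z x : ℝ => x ^ a * fermiKer z x) (x₀ := z)
    (bound := fun x => Real.exp (z + 1) * (x ^ a * Real.exp (-x)))
    (Metric.ball_mem_nhds z one_pos)
    (Filter.Eventually.of_forall fun y => fermi_meas a y)
    (fermi_int a z ha) (ker_meas a z) ?_ ((gamma_int a ha).const_mul _) ?_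
  · exact key.2.deriv
  · refine (ae_restrict_iff' measurableSet_Ioi).2 (Filter.Eventually.of_forall fun x hx y hy => ?_)
    have hp : 0 < x ^ a := Real.rpow_pos_of_pos hx a
    rw [Real.norm_of_nonneg (mul_pos hp (fermiKer_pos y x)).le]
    have h3 : Real.exp y ≤ Real.exp (z + 1) := by
      rw [Metric.mem_ball, Real.dist_eq, abs_lt] at hy
      exact Real.exp_le_exp.2 (by linarith)
    have h4 := (fermiKer_le y x).trans
      (mul_le_mul_of_nonneg_right h3 (Real.exp_pos (-x)).le)
    have := mul_le_mul_of_nonneg_left h4 hp.le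
    linarith
  · refine Filter.Eventually.of_forall fun x y _ => ?_
    have h5 : HasDerivAt (fun y : ℝ => 1 + Real.exp (x - y)) (Real.exp (x - y) * (-1)) y :=
      (((hasDerivAt_id y).const_sub x).exp).const_add 1
    have h6 := (hasDerivAt_const y (x ^ a)).div h5 (by positivity)
    have h8 : (0 * (1 + Real.exp (x - y)) - x ^ a * (Real.exp (x - y) * (-1))) /
        (1 + Real.exp (x - y)) ^ 2 = x ^ a * fermiKer y x := by
      unfold fermiKer
      ring
    rw [h8] at h6
    exact h6

theorem fermi_deriv_inequality
    (α β : ℝ) (hβ : β ≠ 0) (h1 : -1 < α + β) (h2 : -1 < α - β) (z : ℝ) :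
    deriv (fermi (α + β)) z * deriv (fermi (α - β)) z >
      (deriv (fermi α) z) ^ 2 := by
  have h0 : -1 < α := by linarith
  rw [fermi_deriv _ z h1, fermi_deriv _ z h2, fermi_deriv _ z h0]
  have iA := ker_int _ z h1
  have iB := ker_int _ z h2
  have iC := ker_int _ z h0
  have hA : 0 < ∫ x in Ioi (0:ℝ), x ^ (α + β) * fermiKer z x := by
    rw [setIntegral_pos_iff_support_of_nonneg_ae _ iA]
    · have : Function.support (fun x : ℝ => x ^ (α + β) * fermiKer z x) ∩ Ioi 0 = Ioi 0 := by
        refine inter_eq_right.2 fun x hx => ?_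
        exact (mul_pos (Real.rpow_pos_of_pos hx _) (fermiKer_pos z x)).ne'
      rw [this]; simp
    · refine (ae_restrict_iff' measurableSet_Ioi).2 (Filter.Eventually.of_forall fun x hx => ?_)
      exact (mul_pos (Real.rpow_pos_of_pos hx _) (fermiKer_pos z x)).le
  have hQ : ∀ s : ℝ, 0 < s ^ 2 * (∫ x in Ioi (0:ℝ), x ^ (α + β) * fermiKer z x)
      - 2 * s * (∫ x in Ioi (0:ℝ), x ^ α * fermiKer z x)
      + ∫ x in Ioi (0:ℝ), x ^ (α - β) * fermiKer z x := by
    intro s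
    have iAC := (iA.const_mul (s ^ 2)).sub (iC.const_mul (2 * s))
    have iT : IntegrableOn (fun x : ℝ => s ^ 2 * (x ^ (α + β) * fermiKer z x)
        - 2 * s * (x ^ α * fermiKer z x) + x ^ (α - β) * fermiKer z x) (Ioi 0) := iAC.add iB
    have hi : s ^ 2 * (∫ x in Ioi (0:ℝ), x ^ (α + β) * fermiKer z x)
      - 2 * s * (∫ x in Ioi (0:ℝ), x ^ α * fermiKer z x)
      + ∫ x in Ioi (0:ℝ), x ^ (α - β) * fermiKer z x = ∫ x in Ioi (0:ℝ), (s ^ 2 * (x ^ (α + β) * fermiKer z x)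
        - 2 * s * (x ^ α * fermiKer z x) + x ^ (α - β) * fermiKer z x) := by
      rw [← integral_const_mul, ← integral_const_mul,
        ← integral_sub' (iA.const_mul (s ^ 2)) (iC.const_mul (2 * s)), ← integral_add iAC iB]
      rfl
    have hfac : ∀ x ∈ Ioi (0:ℝ), s ^ 2 * (x ^ (α + β) * fermiKer z x)
        - 2 * s * (x ^ α * fermiKer z x) + x ^ (α - β) * fermiKer z x
        = x ^ (α - β) * fermiKer z x * (s * x ^ β - 1) ^ 2 := by
      intro x hx
      have hx' : 0 < x := hx
      have e1 : x ^ α = x ^ (α - β) * x ^ β := by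
        rw [← Real.rpow_add hx']; congr 1; ring
      rw [Real.rpow_add hx', e1]; ring
    rw [hi, setIntegral_pos_iff_support_of_nonneg_ae _ iT]
    · have hsub : Ioi (0:ℝ) \ {(s⁻¹) ^ (β⁻¹)} ⊆ Function.support
          (fun x : ℝ => s ^ 2 * (x ^ (α + β) * fermiKer z x)
        - 2 * s * (x ^ α * fermiKer z x) + x ^ (α - β) * fermiKer z x) ∩ Ioi 0 := by
        rintro x ⟨hx, hne⟩
        refine ⟨?_, hx⟩
        have hx' : 0 < x := hx
        rw [Function.mem_support, hfac x hx]
        refine mul_ne_zero (mul_pos (Real.rpow_pos_of_pos hx _) (fermiKer_pos z x)).ne' ?_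
        refine pow_ne_zero 2 fun h => hne ?_
        have h7 : x ^ β = s⁻¹ := eq_inv_of_mul_eq_one_right (by linarith)
        rw [mem_singleton_iff, ← h7, Real.rpow_rpow_inv hx'.le hβ]
      refine lt_of_lt_of_le ?_ (measure_mono hsub)
      rw [measure_sdiff_null (measure_singleton _)]
      simp
    · refine (ae_restrict_iff' measurableSet_Ioi).2 (Filter.Eventually.of_forall fun x hx => ?_)
      have := hfac x hx
      simp only [Pi.zero_apply]
      rw [this]
      exact mul_nonneg (mul_pos (Real.rpow_pos_of_pos hx _) (fermiKer_pos z x)).le (sq_nonneg _)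
  generalize (∫ x in Ioi (0:ℝ), x ^ (α + β) * fermiKer z x) = A at *
  generalize (∫ x in Ioi (0:ℝ), x ^ (α - β) * fermiKer z x) = B at *
  generalize (∫ x in Ioi (0:ℝ), x ^ α * fermiKer z x) = C at *
  have h := mul_pos hA (hQ (C / A))
  have e : A * ((C / A) ^ 2 * A - 2 * (C / A) * C + B) = A * B - C ^ 2 := by
    field_simp; ring
  linarith
end

section
/- Let d ≥ 2 be an integer and μ > 0. The derivative P_FD' of the Fermi–Dirac pressure is bounded on (0,1]: there exists B > 0 such that 0 < P_FD'(z) ≤ B for all z ∈ (0,1]. Equivalently, writing P_FD(z) = p₁·z^(1+2/d) + R(z) with p₁ = (2/(d+2))·(d/μ)^(2/d), the remainder satisfies R'(z) = O(1) as z → 0⁺. -/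
open Set MeasureTheory Function

/-- The Fermi--Dirac pressure. -/
noncomputable def fermiDiracPressure (d : ℕ) (μ : ℝ) (z : ℝ) : ℝ :=
  (μ / d) * fermi ((d : ℝ) / 2)
    (Function.invFun (fermi ((d : ℝ) / 2 - 1)) (2 * z / μ))

/-- Derivative of the Fermi function. -/
noncomputable def fermiD (α z : ℝ) : ℝ :=
  ∫ x in Set.Ioi (0:ℝ), x ^ α * (Real.exp (x - z) / (1 + Real.exp (x - z)) ^ 2)

lemma fd_int_exp (α : ℝ) (hα : 0 ≤ α) (z : ℝ) :
    IntegrableOn (fun x : ℝ => x ^ α * Real.exp (z - x)) (Ioi 0) := by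
  have h := (Real.GammaIntegral_convergent (s := α + 1) (by linarith)).const_mul (Real.exp z)
  refine h.congr (Filter.Eventually.of_forall fun x => ?_)
  simp only [add_sub_cancel_right, sub_eq_add_neg z x, Real.exp_add]
  ring

lemma fd_eval_exp (α : ℝ) (hα : 0 ≤ α) (z : ℝ) :
    ∫ x in Ioi (0:ℝ), x ^ α * Real.exp (z - x) = Real.exp z * Real.Gamma (α + 1) := by
  rw [Real.Gamma_eq_integral (by linarith), ← integral_const_mul]
  refine integral_congr_ae (Filter.Eventually.of_forall fun x => ?_)
  simp only [add_sub_cancel_right, sub_eq_add_neg z x, Real.exp_add]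
  ring

lemma fd_n_le (t : ℝ) : 1 / (1 + Real.exp t) ≤ Real.exp (-t) := by
  rw [Real.exp_neg, ← one_div]
  exact one_div_le_one_div_of_le (Real.exp_pos t) (by linarith)

lemma fd_m_le (t : ℝ) : Real.exp t / (1 + Real.exp t) ^ 2 ≤ Real.exp (-t) := by
  have := Real.exp_pos t
  rw [Real.exp_neg, ← one_div, div_le_div_iff₀ (by positivity) this]
  nlinarith

lemma fd_int_f (α : ℝ) (hα : 0 ≤ α) (z : ℝ) :
    IntegrableOn (fun x : ℝ => x ^ α / (1 + Real.exp (x - z))) (Ioi 0) := by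
  refine (fd_int_exp α hα z).mono' (Measurable.aestronglyMeasurable (by fun_prop)) ?_
  filter_upwards [ae_restrict_mem measurableSet_Ioi] with x hx
  have hx0 : (0:ℝ) < x := hx
  have h1 : 0 ≤ x ^ α := Real.rpow_nonneg hx0.le _
  rw [Real.norm_of_nonneg (by positivity), div_eq_mul_one_div]
  have := fd_n_le (x - z)
  rw [neg_sub] at this
  gcongr

lemma fd_int_d (α : ℝ) (hα : 0 ≤ α) (z : ℝ) :
    IntegrableOn (fun x : ℝ => x ^ α * (Real.exp (x - z) / (1 + Real.exp (x - z)) ^ 2))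
      (Ioi 0) := by
  refine (fd_int_exp α hα z).mono' (Measurable.aestronglyMeasurable (by fun_prop)) ?_
  filter_upwards [ae_restrict_mem measurableSet_Ioi] with x hx
  have hx0 : (0:ℝ) < x := hx
  have h1 : 0 ≤ x ^ α := Real.rpow_nonneg hx0.le _
  rw [Real.norm_of_nonneg (by positivity)]
  have := fd_m_le (x - z)
  rw [neg_sub] at this
  gcongr

lemma fd_hasDeriv (α : ℝ) (hα : 0 ≤ α) (z : ℝ) :
    HasDerivAt (fermi α) (fermiD α z) z := by
  have := hasDerivAt_integral_of_dominated_loc_of_deriv_le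
    (μ := volume.restrict (Ioi (0:ℝ)))
    (F := fun z x : ℝ => x ^ α / (1 + Real.exp (x - z)))
    (F' := fun z x : ℝ => x ^ α * (Real.exp (x - z) / (1 + Real.exp (x - z)) ^ 2))
    (bound := fun x : ℝ => x ^ α * Real.exp (z + 1 - x)) (x₀ := z)
    (s := Metric.ball z 1) (Metric.ball_mem_nhds z one_pos)
    (Filter.Eventually.of_forall fun w => (fd_int_f α hα w).aestronglyMeasurable)
    (fd_int_f α hα z) (fd_int_d α hα z).aestronglyMeasurable ?_ (fd_int_exp α hα (z + 1)) ?_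
  · exact this.2
  · filter_upwards [ae_restrict_mem measurableSet_Ioi] with x hx w hw
    have hx0 : (0:ℝ) < x := hx
    have h1 : 0 ≤ x ^ α := Real.rpow_nonneg hx0.le _
    rw [Real.norm_of_nonneg (by positivity)]
    have h2 := fd_m_le (x - w)
    rw [neg_sub] at h2
    rw [Metric.mem_ball, Real.dist_eq] at hw
    have h3 : Real.exp (w - x) ≤ Real.exp (z + 1 - x) :=
      Real.exp_le_exp.2 (by linarith [(abs_lt.1 hw).2])
    exact mul_le_mul_of_nonneg_left (h2.trans h3) h1
  · refine Filter.Eventually.of_forall fun x w _ => ?_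
    have h0 := Real.exp_pos (x - w)
    have h1 : HasDerivAt (fun w : ℝ => 1 + Real.exp (x - w)) (Real.exp (x - w) * (-1)) w := by
      have := (((hasDerivAt_id w).const_sub x).exp).const_add 1
      simpa using this
    have h2 := (h1.fun_inv (by positivity)).const_mul (x ^ α)
    have h3 : (fun w : ℝ => x ^ α / (1 + Real.exp (x - w)))
        = fun w : ℝ => x ^ α * (1 + Real.exp (x - w))⁻¹ :=
      funext fun w => div_eq_mul_inv _ _
    change HasDerivAt (fun w : ℝ => x ^ α / (1 + Real.exp (x - w))) _ w
    rw [h3]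
    refine h2.congr_deriv ?_
    simp

lemma fd_D_le (α : ℝ) (hα : 0 ≤ α) (z : ℝ) :
    fermiD α z ≤ Real.exp z * Real.Gamma (α + 1) := by
  rw [← fd_eval_exp α hα]
  refine setIntegral_mono_on (fd_int_d α hα z) (fd_int_exp α hα z) measurableSet_Ioi ?_
  intro x hx
  have h2 := fd_m_le (x - z)
  rw [neg_sub] at h2
  exact mul_le_mul_of_nonneg_left h2 (Real.rpow_nonneg (le_of_lt hx) _)

lemma fd_F_le (α : ℝ) (hα : 0 ≤ α) (z : ℝ) :
    fermi α z ≤ Real.exp z * Real.Gamma (α + 1) := by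
  rw [← fd_eval_exp α hα]
  refine setIntegral_mono_on (fd_int_f α hα z) (fd_int_exp α hα z) measurableSet_Ioi ?_
  intro x hx
  have h2 := fd_n_le (x - z)
  rw [neg_sub] at h2
  rw [div_eq_mul_one_div]
  exact mul_le_mul_of_nonneg_left h2 (Real.rpow_nonneg (le_of_lt hx) _)

lemma fd_D_ge (α : ℝ) (hα : 0 ≤ α) (z w : ℝ) (hzw : z ≤ w) :
    Real.exp z * Real.Gamma (α + 1) / (1 + Real.exp w) ^ 2 ≤ fermiD α z := by
  rw [← fd_eval_exp α hα, ← integral_div]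
  refine setIntegral_mono_on ((fd_int_exp α hα z).div_const _) (fd_int_d α hα z)
    measurableSet_Ioi ?_
  intro x hx
  have hx0 : (0:ℝ) < x := hx
  rw [mul_div_assoc]
  refine mul_le_mul_of_nonneg_left ?_ (Real.rpow_nonneg hx0.le _)
  have ht := Real.exp_pos (x - z)
  have e : Real.exp (z - x) = (Real.exp (x - z))⁻¹ := by rw [← Real.exp_neg, neg_sub]
  have h1 : 1 ≤ Real.exp w * Real.exp (x - z) := by
    rw [← Real.exp_add]; exact Real.one_le_exp (by linarith)
  have hw := Real.exp_pos w
  rw [e, ← one_div, div_div, div_le_div_iff₀ (by positivity) (by positivity)]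
  have h2 : 1 + Real.exp (x - z) ≤ Real.exp (x - z) * (1 + Real.exp w) := by nlinarith
  have h3 := pow_le_pow_left₀ (by positivity) h2 2
  nlinarith

lemma fd_D_pos (α : ℝ) (hα : 0 ≤ α) (z : ℝ) : 0 < fermiD α z := by
  refine lt_of_lt_of_le ?_ (fd_D_ge α hα z z le_rfl)
  have := Real.Gamma_pos_of_pos (s := α + 1) (by linarith)
  positivity

lemma fd_strictMono (α : ℝ) (hα : 0 ≤ α) : StrictMono (fermi α) :=
  strictMono_of_deriv_pos fun z => by
    rw [(fd_hasDeriv α hα z).deriv]; exact fd_D_pos α hα z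

lemma fd_nonneg (α z : ℝ) : 0 ≤ fermi α z := by
  refine setIntegral_nonneg measurableSet_Ioi fun x hx => ?_
  have : 0 ≤ x ^ α := Real.rpow_nonneg (le_of_lt hx) _
  positivity

lemma fd_pos (α : ℝ) (hα : 0 ≤ α) (z : ℝ) : 0 < fermi α z :=
  lt_of_le_of_lt (fd_nonneg α (z - 1)) (fd_strictMono α hα (by linarith))

lemma fd_F_ge (α : ℝ) (hα : 0 ≤ α) (b : ℝ) (hb : 1 ≤ b) : (b - 1) / 2 ≤ fermi α b := by
  have h1 : ∫ x in Ioc (1:ℝ) b, x ^ α / (1 + Real.exp (x - b)) ≤ fermi α b := by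
    refine setIntegral_mono_set (fd_int_f α hα b) ?_ ?_
    · filter_upwards [ae_restrict_mem measurableSet_Ioi] with x hx
      have : 0 ≤ x ^ α := Real.rpow_nonneg (le_of_lt hx) _
      simp only [Pi.zero_apply]
      positivity
    · exact Filter.Eventually.of_forall fun x hx => lt_trans one_pos hx.1
  refine le_trans ?_ h1
  have h2 : ∫ x in Ioc (1:ℝ) b, (1/2 : ℝ) = (b - 1) / 2 := by
    simp [hb]; ring
  rw [← h2]
  refine setIntegral_mono_on (by simp) ((fd_int_f α hα b).mono_set
    fun x hx => lt_trans one_pos hx.1) measurableSet_Ioc ?_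
  intro x hx
  have h3 : 1 ≤ x ^ α := Real.one_le_rpow hx.1.le hα
  have h4 : Real.exp (x - b) ≤ 1 := Real.exp_le_one_iff.2 (by linarith [hx.2])
  have := Real.exp_pos (x - b)
  rw [div_le_div_iff₀ (by positivity) (by positivity)]
  nlinarith

lemma fd_surj (α : ℝ) (hα : 0 ≤ α) (y : ℝ) (hy : 0 < y) : ∃ w, fermi α w = y := by
  have hG := Real.Gamma_pos_of_pos (s := α + 1) (by linarith)
  have hc : Continuous (fermi α) :=
    continuous_iff_continuousAt.2 fun z => (fd_hasDeriv α hα z).continuousAt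
  refine mem_range_of_exists_le_of_exists_ge hc
    ⟨Real.log (y / Real.Gamma (α + 1)), ?_⟩ ⟨2 * y + 1, ?_⟩
  · refine (fd_F_le α hα _).trans ?_
    rw [Real.exp_log (by positivity), div_mul_cancel₀ _ hG.ne']
  · have := fd_F_ge α hα (2 * y + 1) (by linarith)
    linarith

lemma fd_inv_hasDeriv (α : ℝ) (hα : 0 ≤ α) (y : ℝ) (hy : 0 < y) :
    HasDerivAt (invFun (fermi α)) (fermiD α (invFun (fermi α) y))⁻¹ y := by
  have hr : ∀ y, 0 < y → fermi α (invFun (fermi α) y) = y :=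
    fun y hy => invFun_eq (fd_surj α hα y hy)
  have hl : ∀ w, invFun (fermi α) (fermi α w) = w :=
    leftInverse_invFun (fd_strictMono α hα).injective
  have hm : StrictMonoOn (invFun (fermi α)) (Ioi 0) := by
    intro a ha b hb hab
    rw [← (fd_strictMono α hα).lt_iff_lt, hr a ha, hr b hb]
    exact hab
  have hi : invFun (fermi α) '' Ioi 0 = univ := by
    refine eq_univ_of_forall fun w => ⟨fermi α w, fd_pos α hα w, hl w⟩
  have hc : ContinuousAt (invFun (fermi α)) y :=
    hm.continuousAt_of_image_mem_nhds (Ioi_mem_nhds hy) (by rw [hi]; exact Filter.univ_mem)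
  refine (fd_hasDeriv α hα _).of_local_left_inverse hc (fd_D_pos α hα _).ne' ?_
  filter_upwards [Ioi_mem_nhds hy] with t ht using hr t ht

theorem fermiDiracPressure_deriv_bounded_near_zero
    (d : ℕ) (hd : 2 ≤ d) (μ : ℝ) (hμ : 0 < μ) :
    ∃ B > (0:ℝ), ∀ z ∈ Set.Ioc (0:ℝ) 1,
      0 < deriv (fermiDiracPressure d μ) z ∧
      deriv (fermiDiracPressure d μ) z ≤ B := by
  have hd' : (2:ℝ) ≤ d := by exact_mod_cast hd
  have hα : (0:ℝ) ≤ (d:ℝ) / 2 - 1 := by linarith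
  have hβ : (0:ℝ) ≤ (d:ℝ) / 2 := by linarith
  set α : ℝ := (d:ℝ) / 2 - 1 with hαd
  set β : ℝ := (d:ℝ) / 2 with hβd
  set g := invFun (fermi α) with hg
  have hGα := Real.Gamma_pos_of_pos (s := α + 1) (by linarith)
  have hGβ := Real.Gamma_pos_of_pos (s := β + 1) (by linarith)
  have hr : ∀ y, 0 < y → fermi α (g y) = y :=
    fun y hy => invFun_eq (fd_surj α hα y hy)
  have hdp : (0:ℝ) < d := by linarith
  set w₁ := g (2 * 1 / μ) with hw₁
  refine ⟨(μ / d) * (Real.Gamma (β + 1) * (1 + Real.exp w₁) ^ 2 / Real.Gamma (α + 1) * (2 / μ)),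
    by positivity, ?_⟩
  intro z hz
  have hy : 0 < 2 * z / μ := by have := hz.1; positivity
  have hD : HasDerivAt (fermiDiracPressure d μ)
      ((μ / d) * (fermiD β (g (2 * z / μ)) * ((fermiD α (g (2 * z / μ)))⁻¹ * (2 / μ)))) z := by
    have h1 : HasDerivAt (fun z : ℝ => 2 * z / μ) (2 / μ) z := by
      simpa using ((hasDerivAt_id z).const_mul 2).div_const μ
    have h2 : HasDerivAt (fun z : ℝ => g (2 * z / μ))
        ((fermiD α (g (2 * z / μ)))⁻¹ * (2 / μ)) z :=
      HasDerivAt.comp z (fd_inv_hasDeriv α hα _ hy) h1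
    have h3 : HasDerivAt (fun z : ℝ => fermi β (g (2 * z / μ))) _ z :=
      HasDerivAt.comp z (fd_hasDeriv β hβ _) h2
    exact h3.const_mul (μ / d)
  rw [hD.deriv]
  have hle : g (2 * z / μ) ≤ w₁ := by
    rw [← (fd_strictMono α hα).le_iff_le, hr _ hy, hw₁, hr _ (by positivity)]
    have := hz.2
    gcongr
  generalize g (2 * z / μ) = w at *
  have pα := fd_D_pos α hα w
  have pβ := fd_D_pos β hβ w
  refine ⟨by positivity, ?_⟩
  rw [← mul_assoc (fermiD β w)]
  gcongr
  rw [← div_eq_mul_inv, div_le_div_iff₀ pα hGα]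
  have hu := fd_D_le β hβ w
  have hl := fd_D_ge α hα w w₁ hle
  rw [div_le_iff₀ (by positivity)] at hl
  calc fermiD β w * Real.Gamma (α + 1)
      ≤ Real.exp w * Real.Gamma (β + 1) * Real.Gamma (α + 1) := by gcongr
    _ = Real.Gamma (β + 1) * (Real.exp w * Real.Gamma (α + 1)) := by ring
    _ ≤ Real.Gamma (β + 1) * (fermiD α w * (1 + Real.exp w₁) ^ 2) := by gcongr
    _ = _ := by ring
end
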